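/- Let N be a strictly convex norm on ℝ^{2n} and let d_SF be the associated sub-Finsler distance on the n-th Heisenberg group ℍⁿ. Then every infinite geodesic γ:ℝ→(ℍⁿ, d_SF) is a horizontal line, i.e. there exist g₀∈ℍⁿ and w∈ℝ^{2n} with N(w)=1 such that γ(s)=g₀*(s w, 0) for all s∈ℝ. -/

import Mathlib

open MeasureTheory Set

noncomputable section

/-- `ℝ^{2n}`, with the Euclidean norm. -/
abbrev V (n : ℕ) := EuclideanSpace ℝ (Fin (2 * n))

/-- The `n`-th Heisenberg group as a set: `ℝ^{2n} × ℝ`. -/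
abbrev Heis (n : ℕ) := V n × ℝ

/-- Euclidean dot product on `ℝ^{2n}`. -/
def dot {n : ℕ} (p z : V n) : ℝ := ∑ i, p i * z i

/-- Index `i` as an element of the first half of `Fin (2n)`. -/
def fstIdx {n : ℕ} (i : Fin n) : Fin (2 * n) := ⟨i.1, by have := i.isLt; omega⟩

/-- Index `n + i` as an element of the second half of `Fin (2n)`. -/
def sndIdx {n : ℕ} (i : Fin n) : Fin (2 * n) := ⟨n + i.1, by have := i.isLt; omega⟩

/-- The symplectic form `⟨z, J_n z'⟩ = ∑ (y_i x'_i - x_i y'_i)` on `ℝ^{2n}`. -/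
def symp {n : ℕ} (z z' : V n) : ℝ :=
  ∑ i : Fin n, (z (sndIdx i) * z' (fstIdx i) - z (fstIdx i) * z' (sndIdx i))

/-- Heisenberg group multiplication. -/
def hmul {n : ℕ} (g g' : Heis n) : Heis n :=
  (g.1 + g'.1, g.2 + g'.2 + 2 * symp g.1 g'.1)

/-- Heisenberg group inverse. -/
def hinv {n : ℕ} (g : Heis n) : Heis n := (-g.1, -g.2)

/-- Heisenberg dilation `δ_λ(z,t) = (λ z, λ² t)`. -/
def dil {n : ℕ} (l : ℝ) (g : Heis n) : Heis n := (l • g.1, l ^ 2 * g.2)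

/-- `N : ℝ^{2n} → ℝ` is a norm. -/
structure IsNorm {n : ℕ} (N : V n → ℝ) : Prop where
  nonneg : ∀ z, 0 ≤ N z
  eq_zero_iff : ∀ z, N z = 0 ↔ z = 0
  smul : ∀ (a : ℝ) (z : V n), N (a • z) = |a| * N z
  triangle : ∀ z z', N (z + z') ≤ N z + N z'

/-- `N` is a strictly convex norm: additivity of the norm forces positive collinearity. -/
def StrictlyConvexNorm {n : ℕ} (N : V n → ℝ) : Prop :=
  ∀ z z' : V n, z ≠ 0 → z' ≠ 0 → N (z + z') = N z + N z' →
    ∃ α : ℝ, 0 < α ∧ z' = α • z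

/-- The subdifferential of `f : ℝ^{2n} → ℝ` at `z`. -/
def subdiff {n : ℕ} (f : V n → ℝ) (z : V n) : Set (V n) :=
  {p | ∀ z', f z + dot p (z' - z) ≤ f z'}

/-- A norm is smooth if its subdifferential is a singleton away from the origin. -/
def SmoothNorm {n : ℕ} (N : V n → ℝ) : Prop :=
  ∀ z : V n, z ≠ 0 → ∃ p : V n, subdiff N z = {p}

/-- The dual norm `N_*(p) = sup { p·z : N(z) = 1 }`. -/
def dualN {n : ℕ} (N : V n → ℝ) (p : V n) : ℝ :=
  sSup ((fun z => dot p z) '' {z | N z = 1})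

/-- `F_N(z) = ½ N(z)²`. -/
def FN {n : ℕ} (N : V n → ℝ) (z : V n) : ℝ := (1 / 2) * (N z) ^ 2

/-- The Legendre transform `f*(p) = sup_z (p·z - f(z))`. -/
def legendre {n : ℕ} (f : V n → ℝ) (p : V n) : ℝ :=
  ⨆ z : V n, (dot p z - f z)

/-- A horizontal (absolutely continuous) curve on `[a,b]`, encoded via an integrable
horizontal velocity `v = γ̇_I` together with the integral form of the horizontality
condition for the last coordinate. -/
structure HorizCurve (n : ℕ) (a b : ℝ) where
  γ : ℝ → Heis n
  v : ℝ → V n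
  intg : IntegrableOn v (Icc a b)
  pos : ∀ s ∈ Icc a b, (γ s).1 = (γ a).1 + ∫ u in a..s, v u
  vert : ∀ s ∈ Icc a b, (γ s).2 = (γ a).2 + ∫ u in a..s, 2 * symp ((γ u).1) (v u)

/-- The sub-Finsler distance associated to the norm `N` on `ℍⁿ`. -/
def dSF (n : ℕ) (N : V n → ℝ) (g g' : Heis n) : ℝ :=
  sInf { L | ∃ (a b : ℝ) (c : HorizCurve n a b), a ≤ b ∧ c.γ a = g ∧ c.γ b = g' ∧
    L = ∫ s in a..b, N (c.v s) }

/-- Horizontal projection of the trajectory of the control `v`,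
solving `γ̇_I = -v`, `γ_I(0) = 0`. -/
def trajI (n : ℕ) (v : ℝ → V n) (s : ℝ) : V n := -∫ u in (0:ℝ)..s, v u

/-- The trajectory of the control `v`: solves `ẋ_i = -v_i`, `ẏ_i = -v_{n+i}`,
`ṫ = -2∑(y_i v_i - x_i v_{n+i})`, starting at the neutral element. -/
def traj (n : ℕ) (v : ℝ → V n) (s : ℝ) : Heis n :=
  (trajI n v s, -∫ u in (0:ℝ)..s, 2 * symp (trajI n v u) (v u))

/-- `v` is an admissible control steering `e` to `g` in time `T`. -/
def Admissible (n : ℕ) (T : ℝ) (g : Heis n) (v : ℝ → V n) : Prop :=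
  IntegrableOn v (Icc 0 T) ∧ traj n v T = g

/-- `v` is optimal for the energy problem (P). -/
def OptimalEnergy (n : ℕ) (N : V n → ℝ) (T : ℝ) (g : Heis n) (v : ℝ → V n) : Prop :=
  Admissible n T g v ∧ ∀ w : ℝ → V n, Admissible n T g w →
    (∫ s in (0:ℝ)..T, FN N (v s)) ≤ ∫ s in (0:ℝ)..T, FN N (w s)

/-- `v` is optimal for the length problem. -/
def OptimalLength (n : ℕ) (N : V n → ℝ) (T : ℝ) (g : Heis n) (v : ℝ → V n) : Prop :=
  Admissible n T g v ∧ ∀ w : ℝ → V n, Admissible n T g w →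
    (∫ s in (0:ℝ)..T, N (v s)) ≤ ∫ s in (0:ℝ)..T, N (w s)

/-- The standard symplectic matrix `J_n` acting on `ℝ^{2n}`:
`(J z)_i = -z_{n+i}`, `(J z)_{n+i} = z_i`. -/
def Jmat (n : ℕ) (z : V n) : V n :=
  (EuclideanSpace.equiv (Fin (2 * n)) ℝ).symm
    (fun j => if h : (j : ℕ) < n then -z ⟨n + (j : ℕ), by have := j.isLt; omega⟩
      else z ⟨(j : ℕ) - n, by have := j.isLt; omega⟩)

/-- The function `a` associated to a multiplier `λ` (with `λ_{2n+1} ≡ k`) and a control `v`: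
`a_i = λ_i + 2k y_i`, `a_{n+i} = λ_{n+i} - 2k x_i`, where `(x,y) = γ_I` is the horizontal
projection of the trajectory of `v`. -/
def afun (n : ℕ) (v : ℝ → V n) (lam : ℝ → V n) (k : ℝ) (s : ℝ) : V n :=
  lam s - (2 * k) • Jmat n (trajI n v s)

/-- A Pontryagin multiplier `(λ₀, λ)` for the control `v` on `[0,T]` for problem (P):
`λ = (λ_I, k)` with `λ_{2n+1} ≡ k` constant, `λ̇_i = -2k v_{n+i}`, `λ̇_{n+i} = 2k v_i`
(in integrated form), nontriviality, the pointwise minimum principle, and constancy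
of the minimized Hamiltonian. -/
structure PMP (n : ℕ) (N : V n → ℝ) (T : ℝ) (v : ℝ → V n) (l0 : ℝ) where
  lam : ℝ → V n
  k : ℝ
  lam_eq : ∀ s ∈ Icc (0:ℝ) T,
    lam s = lam 0 + (2 * k) • ∫ u in (0:ℝ)..s, Jmat n (v u)
  nontriv : ¬(l0 = 0 ∧ k = 0 ∧ lam 0 = 0)
  argmin : ∀ s ∈ Icc (0:ℝ) T, ∀ u : V n,
    l0 * FN N (v s) - dot (afun n v lam k s) (v s) ≤ l0 * FN N u - dot (afun n v lam k s) u
  isConst : ∃ c : ℝ, ∀ s ∈ Icc (0:ℝ) T,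
    l0 * FN N (v s) - dot (afun n v lam k s) (v s) = c

/-- A homogeneous norm on the Heisenberg group `ℍⁿ`. -/
structure IsHomNorm {n : ℕ} (Nh : Heis n → ℝ) : Prop where
  nonneg : ∀ g, 0 ≤ Nh g
  eq_zero_iff : ∀ g, Nh g = 0 ↔ g = ((0 : V n), (0 : ℝ))
  symm : ∀ g, Nh (hinv g) = Nh g
  triangle : ∀ g g', Nh (hmul g g') ≤ Nh g + Nh g'
  homog : ∀ l : ℝ, 0 < l → ∀ g, Nh (dil l g) = l * Nh g

/-- The geodesic linearity property: every infinite geodesic of `(ℍⁿ, d)` is an affine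
line in `ℝ^{2n+1}`. -/
def GLP (n : ℕ) (d : Heis n → Heis n → ℝ) : Prop :=
  ∀ γ : ℝ → Heis n, (∀ s s' : ℝ, d (γ s) (γ s') = |s - s'|) →
    ∃ p u : Heis n, ∀ s : ℝ, γ s = p + s • u

/-- An infinite multiplier for the control `v` on `[0,∞)`. -/
def IsInfMult (n : ℕ) (N : V n → ℝ) (v : ℝ → V n) (lam : ℝ → V n) (k : ℝ) : Prop :=
  ∀ T : ℝ, 0 < T → ∃ m : PMP n N T v 1, m.lam = lam ∧ m.k = k

theorem symp_add_left {n : ℕ} (x y z : V n) : symp (x + y) z = symp x z + symp y z := by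
  simp only [symp, PiLp.add_apply, ← Finset.sum_add_distrib]
  exact Finset.sum_congr rfl fun i _ => by ring

theorem symp_smul_left {n : ℕ} (r : ℝ) (x z : V n) : symp (r • x) z = r * symp x z := by
  simp only [symp, PiLp.smul_apply, smul_eq_mul, Finset.mul_sum]
  exact Finset.sum_congr rfl fun i _ => by ring

theorem symp_swap {n : ℕ} (x y : V n) : symp y x = -symp x y := by
  simp only [symp, ← Finset.sum_neg_distrib]
  exact Finset.sum_congr rfl fun i _ => by ring

theorem symp_self {n : ℕ} (x : V n) : symp x x = 0 := by
  linarith [symp_swap x x]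

theorem symp_add_right {n : ℕ} (x y z : V n) : symp z (x + y) = symp z x + symp z y := by
  rw [symp_swap, symp_add_left, symp_swap z x, symp_swap z y]; ring

theorem symp_smul_right {n : ℕ} (r : ℝ) (x z : V n) : symp z (r • x) = r * symp z x := by
  rw [symp_swap, symp_smul_left, symp_swap z x]; ring

theorem symp_neg_left {n : ℕ} (x z : V n) : symp (-x) z = -symp x z := by
  simpa using symp_smul_left (-1) x z

theorem symp_neg_right {n : ℕ} (x z : V n) : symp z (-x) = -symp z x := by
  simpa using symp_smul_right (-1) x z

theorem symp_zero_right {n : ℕ} (z : V n) : symp z 0 = 0 := by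
  simpa using symp_smul_right 0 0 z

theorem continuous_symp {n : ℕ} : Continuous fun x : V n × V n => symp x.1 x.2 := by
  unfold symp; fun_prop

/-- The continuous linear functional `⟨x, J_n ·⟩`. -/
def sympCLM {n : ℕ} (x : V n) : V n →L[ℝ] ℝ :=
  LinearMap.toContinuousLinearMap
    { toFun := symp x
      map_add' := fun y z => symp_add_right y z x
      map_smul' := fun r y => symp_smul_right r y x }

theorem sum_fstIdx_add_sndIdx {n : ℕ} (f : Fin (2 * n) → ℝ) :
    ∑ j, f j = ∑ i : Fin n, (f (fstIdx i) + f (sndIdx i)) := by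
  rw [← (finCongr (two_mul n).symm).sum_comp f, Fin.sum_univ_add, ← Finset.sum_add_distrib]
  rfl

theorem Jmat_fstIdx {n : ℕ} (z : V n) (i : Fin n) : Jmat n z (fstIdx i) = -z (sndIdx i) := by
  simp [Jmat, fstIdx, sndIdx]

theorem Jmat_sndIdx {n : ℕ} (z : V n) (i : Fin n) : Jmat n z (sndIdx i) = z (fstIdx i) := by
  simp [Jmat, fstIdx, sndIdx]

theorem symp_eq_inner {n : ℕ} (x y : V n) : symp x y = inner ℝ x (Jmat n y) := by
  simp only [PiLp.inner_apply, sum_fstIdx_add_sndIdx, Jmat_fstIdx, Jmat_sndIdx, symp]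
  exact Finset.sum_congr rfl fun i _ => by simp; ring

theorem norm_Jmat {n : ℕ} (z : V n) : ‖Jmat n z‖ = ‖z‖ := by
  simp only [EuclideanSpace.norm_eq, sum_fstIdx_add_sndIdx, Jmat_fstIdx, Jmat_sndIdx, norm_neg]
  simp only [add_comm]

theorem abs_symp_le {n : ℕ} (x y : V n) : |symp x y| ≤ ‖x‖ * ‖y‖ := by
  rw [symp_eq_inner, ← norm_Jmat y]
  exact abs_real_inner_le_norm _ _

theorem symp_Jmat_self {n : ℕ} (z : V n) : symp (Jmat n z) z = ‖z‖ ^ 2 := by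
  rw [symp_eq_inner, real_inner_self_eq_norm_sq, norm_Jmat]

namespace IsNorm

variable {n : ℕ} {N : V n → ℝ}

theorem map_zero (hN : IsNorm N) : N 0 = 0 := (hN.eq_zero_iff 0).2 rfl

theorem map_neg (hN : IsNorm N) (z : V n) : N (-z) = N z := by
  simpa using hN.smul (-1) z

theorem map_sum_le (hN : IsNorm N) {ι : Type*} (s : Finset ι) (f : ι → V n) :
    N (∑ i ∈ s, f i) ≤ ∑ i ∈ s, N (f i) := by
  classical
  induction s using Finset.induction_on with
  | empty => simp [hN.map_zero]
  | insert a s ha ih =>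
    rw [Finset.sum_insert ha, Finset.sum_insert ha]
    exact (hN.triangle _ _).trans (by gcongr)

theorem exists_le_norm (hN : IsNorm N) : ∃ C, 0 < C ∧ ∀ z, N z ≤ C * ‖z‖ := by
  let b := EuclideanSpace.basisFun (Fin (2 * n)) ℝ
  have hC : 0 ≤ ∑ i, N (b i) := Finset.sum_nonneg fun i _ => hN.nonneg _
  refine ⟨∑ i, N (b i) + 1, by linarith, fun z => ?_⟩
  calc N z = N (∑ i, z i • b i) := by
        congr 1; simpa [b] using (b.sum_repr z).symm
    _ ≤ ∑ i, N (z i • b i) := hN.map_sum_le _ _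
    _ ≤ ∑ i, N (b i) * ‖z‖ := by
        refine Finset.sum_le_sum fun i _ => ?_
        rw [hN.smul, mul_comm]
        exact mul_le_mul_of_nonneg_left (PiLp.norm_apply_le z i) (hN.nonneg _)
    _ ≤ (∑ i, N (b i) + 1) * ‖z‖ := by
        rw [← Finset.sum_mul]; gcongr; linarith

theorem continuous (hN : IsNorm N) : Continuous N := by
  obtain ⟨C, hC, h⟩ := hN.exists_le_norm
  have key : ∀ x y, N x - N y ≤ C * ‖x - y‖ := fun x y => by
    have h1 := hN.triangle (x - y) y
    rw [sub_add_cancel] at h1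
    linarith [h (x - y)]
  refine (LipschitzWith.of_dist_le_mul (K := ⟨C, hC.le⟩) fun x y => ?_).continuous
  rw [Real.dist_eq, dist_eq_norm, abs_le]
  have h1 := key x y
  have h2 := key y x
  rw [norm_sub_rev] at h2
  exact ⟨by change -(C * _) ≤ _; linarith, h1⟩

theorem exists_norm_le (hN : IsNorm N) : ∃ c, 0 < c ∧ ∀ z, ‖z‖ ≤ c * N z := by
  rcases (Metric.sphere (0 : V n) 1).eq_empty_or_nonempty with he | hne
  · refine ⟨1, one_pos, fun z => ?_⟩
    by_cases hz : z = 0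
    · simp [hz, hN.map_zero]
    · have : (‖z‖⁻¹ • z) ∈ Metric.sphere (0 : V n) 1 := by
        simp [norm_smul, hz]
      simp [he] at this
  · obtain ⟨x, hx, hmin⟩ := (isCompact_sphere (0 : V n) 1).exists_isMinOn hne
      hN.continuous.continuousOn
    have hx0 : x ≠ 0 := by rintro rfl; simp at hx
    have hNx : 0 < N x := (hN.nonneg x).lt_of_ne fun h => hx0 ((hN.eq_zero_iff x).1 h.symm)
    refine ⟨(N x)⁻¹, inv_pos.2 hNx, fun z => ?_⟩
    by_cases hz : z = 0
    · simp [hz, hN.map_zero]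
    · have hz' : 0 < ‖z‖ := norm_pos_iff.2 hz
      have : N x ≤ N (‖z‖⁻¹ • z) := hmin (by simp [norm_smul, hz])
      rw [hN.smul, abs_of_pos (inv_pos.2 hz'), le_inv_mul_iff₀ hz'] at this
      rw [le_inv_mul_iff₀ hNx]; linarith

theorem convexOn (hN : IsNorm N) : ConvexOn ℝ univ N := by
  refine ⟨convex_univ, fun x _ y _ a b ha hb _ => (hN.triangle _ _).trans_eq ?_⟩
  rw [hN.smul, hN.smul, abs_of_nonneg ha, abs_of_nonneg hb, smul_eq_mul, smul_eq_mul]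

theorem integrable_comp (hN : IsNorm N) {v : ℝ → V n} (hv : Integrable v) :
    Integrable fun u => N (v u) := by
  obtain ⟨C, -, h⟩ := hN.exists_le_norm
  refine (hv.norm.const_mul C).mono' (hN.continuous.comp_aestronglyMeasurable hv.1)
    (.of_forall fun u => ?_)
  rw [Real.norm_of_nonneg (hN.nonneg _)]
  exact h _

theorem map_integral_le (hN : IsNorm N) {v : ℝ → V n} (hv : Integrable v) {a b : ℝ}
    (hab : a ≤ b) : N (∫ u in a..b, v u) ≤ ∫ u in a..b, N (v u) := by
  rcases hab.eq_or_lt with rfl | hlt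
  · simp [hN.map_zero]
  have : NeZero (volume.restrict (Ioc a b)) :=
    ⟨by rw [Ne, Measure.restrict_eq_zero]; simp [hlt]⟩
  have h := hN.convexOn.map_average_le (μ := volume.restrict (Ioc a b)) (f := v)
    hN.continuous.continuousOn isClosed_univ (by simp) hv.integrableOn
    (hN.integrable_comp hv).integrableOn
  have hpos : 0 < b - a := sub_pos.2 hlt
  rw [← uIoc_of_le hab, interval_average_eq, interval_average_eq, hN.smul,
    abs_of_pos (inv_pos.2 hpos), smul_eq_mul] at h
  exact le_of_mul_le_mul_left h (inv_pos.2 hpos)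

end IsNorm

/-- The vertical coordinate at time `s` of the horizontal curve issuing from the neutral element
at time `a` with horizontal velocity `v`. -/
def area {n : ℕ} (v : ℝ → V n) (a s : ℝ) : ℝ :=
  ∫ u in a..s, 2 * symp (∫ r in a..u, v r) (v u)

theorem aestronglyMeasurable_symp {n : ℕ} {f g : ℝ → V n}
    (hf : AEStronglyMeasurable f volume) (hg : AEStronglyMeasurable g volume) :
    AEStronglyMeasurable (fun u => symp (f u) (g u)) volume :=
  continuous_symp.comp_aestronglyMeasurable (hf.prodMk hg)

theorem integrable_symp_primitive {n : ℕ} {v : ℝ → V n} (hv : Integrable v) (p : V n) (a : ℝ) :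
    Integrable fun u => 2 * symp (p + ∫ r in a..u, v r) (v u) := by
  have hz : Continuous fun u => ∫ r in a..u, v r := hv.continuous_primitive a
  have hmeas : AEStronglyMeasurable (fun u => symp (p + ∫ r in a..u, v r) (v u)) volume :=
    aestronglyMeasurable_symp (continuous_const.add hz).aestronglyMeasurable hv.1
  refine (hv.norm.const_mul (2 * (‖p‖ + ∫ r, ‖v r‖))).mono' (hmeas.const_mul 2)
    (.of_forall fun u => ?_)
  have h1 : ‖∫ r in a..u, v r‖ ≤ ∫ r, ‖v r‖ :=
    intervalIntegral.norm_integral_le_integral_norm_uIoc.trans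
      (setIntegral_le_integral hv.norm (.of_forall fun _ => norm_nonneg _))
  have h2 : ‖p + ∫ r in a..u, v r‖ ≤ ‖p‖ + ∫ r, ‖v r‖ :=
    (norm_add_le _ _).trans (add_le_add_right h1 _)
  rw [norm_mul, Real.norm_ofNat, Real.norm_eq_abs, mul_assoc]
  exact mul_le_mul_of_nonneg_left
    ((abs_symp_le _ _).trans (mul_le_mul_of_nonneg_right h2 (norm_nonneg _))) zero_le_two

theorem integral_symp_add {n : ℕ} {v : ℝ → V n} (hv : Integrable v) (p : V n) (a s : ℝ) :
    ∫ u in a..s, 2 * symp (p + ∫ r in a..u, v r) (v u) =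
      2 * symp p (∫ u in a..s, v u) + area v a s := by
  have h1 : ∫ u in a..s, sympCLM p (v u) = symp p (∫ u in a..s, v u) :=
    (sympCLM p).intervalIntegral_comp_comm hv.intervalIntegrable
  have h2 : Integrable fun u => sympCLM p (v u) := (sympCLM p).integrable_comp hv
  have h3 := integrable_symp_primitive hv 0 a
  simp only [zero_add] at h3
  rw [area, ← h1, ← intervalIntegral.integral_const_mul,
    ← intervalIntegral.integral_add (h2.const_mul 2).intervalIntegrable h3.intervalIntegrable]
  refine intervalIntegral.integral_congr fun u _ => ?_
  simp only [symp_add_left, sympCLM, LinearMap.coe_toContinuousLinearMap', LinearMap.coe_mk,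
    AddHom.coe_mk]
  ring

/-- A horizontal curve of `N`-length `L` joins the neutral element to `x`. -/
def Reach {n : ℕ} (N : V n → ℝ) (x : Heis n) (L : ℝ) : Prop :=
  ∃ (a b : ℝ) (v : ℝ → V n), a ≤ b ∧ Integrable v ∧ ∫ u in a..b, v u = x.1 ∧
    area v a b = x.2 ∧ ∫ u in a..b, N (v u) = L

theorem exists_horizCurve_iff_reach {n : ℕ} (N : V n → ℝ) (g g' : Heis n) (L : ℝ) :
    (∃ (a b : ℝ) (c : HorizCurve n a b), a ≤ b ∧ c.γ a = g ∧ c.γ b = g' ∧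
      L = ∫ s in a..b, N (c.v s)) ↔ Reach N (hmul (hinv g) g') L := by
  constructor
  · rintro ⟨a, b, c, hab, rfl, rfl, rfl⟩
    set v := (Icc a b).indicator c.v with hv
    have hvi : Integrable v := c.intg.integrable_indicator measurableSet_Icc
    have hvc : ∀ u ∈ Icc a b, v u = c.v u := fun u hu => indicator_of_mem hu _
    have hsub : ∀ s ∈ Icc a b, uIcc a s ⊆ Icc a b := fun s hs => by
      rw [uIcc_of_le hs.1]; exact Icc_subset_Icc_right hs.2
    have hint : ∀ s ∈ Icc a b, ∫ u in a..s, v u = ∫ u in a..s, c.v u := fun s hs =>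
      intervalIntegral.integral_congr fun u hu => hvc u (hsub s hs hu)
    have hb : b ∈ Icc a b := right_mem_Icc.2 hab
    have hpos : (c.γ b).1 = (c.γ a).1 + ∫ u in a..b, v u := by rw [c.pos b hb, hint b hb]
    have hvert : (c.γ b).2 = (c.γ a).2 + (2 * symp (c.γ a).1 (∫ u in a..b, v u) + area v a b) := by
      rw [c.vert b hb, ← integral_symp_add hvi]
      congr 1
      refine intervalIntegral.integral_congr fun u hu => ?_
      have hu' := hsub b hb hu
      simp only [c.pos u hu', hint u hu', hvc u hu']
    refine ⟨a, b, v, hab, hvi, ?_, ?_, intervalIntegral.integral_congr fun u hu => ?_⟩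
    · simp [hmul, hinv, hpos]
    · simp only [hmul, hinv, hpos, hvert, symp_add_right, symp_neg_left, symp_self]
      ring
    · simp only [hvc u (hsub b hb hu)]
  · rintro ⟨a, b, v, hab, hvi, h1, h2, rfl⟩
    refine ⟨a, b, ⟨fun s => hmul g (∫ u in a..s, v u, area v a s), v, hvi.integrableOn,
      fun s _ => ?_, fun s _ => ?_⟩, hab, ?_, ?_, rfl⟩
    · simp [hmul]
    · simp only [hmul, integral_symp_add hvi, intervalIntegral.integral_same, area,
        symp_zero_right]
      ring
    · simp [hmul, area, symp_zero_right]
    · refine Prod.ext ?_ ?_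
      · simp [h1, hmul, hinv]
      · simp only [h1, h2, hmul, hinv, symp_add_right, symp_neg_left, symp_neg_right, symp_self]
        ring

theorem dSF_eq {n : ℕ} (N : V n → ℝ) (g g' : Heis n) :
    dSF n N g g' = sInf {L | Reach N (hmul (hinv g) g') L} := by
  simp only [dSF, exists_horizCurve_iff_reach]

namespace Reach

variable {n : ℕ} {N : V n → ℝ} {x y : Heis n} {L M : ℝ}

theorem mul (hN : IsNorm N) (hx : Reach N x L) (hy : Reach N y M) : Reach N (hmul x y) (L + M) := by
  obtain ⟨a, b, v, hab, hv, hx1, hx2, rfl⟩ := hx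
  obtain ⟨c, d, w, hcd, hw, hy1, hy2, rfl⟩ := hy
  set e := b + (d - c) with he
  have hbe : b ≤ e := by linarith
  set f : ℝ → V n := fun u => if u ≤ b then v u else w (u - (b - c)) with hf
  have hfi : Integrable f :=
    Integrable.piecewise (s := Iic b) measurableSet_Iic hv.integrableOn
      (hw.comp_sub_right (b - c)).integrableOn
  have hf1 : ∀ u ≤ b, f u = v u := fun u hu => if_pos hu
  have hf2 : ∀ u, b < u → f u = w (u - (b - c)) := fun u hu => if_neg hu.not_ge
  have hz1 : ∀ u ∈ Icc a b, ∫ r in a..u, f r = ∫ r in a..u, v r := fun u hu =>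
    intervalIntegral.integral_congr fun r hr => by
      rw [uIcc_of_le hu.1] at hr
      exact hf1 r (hr.2.trans hu.2)
  have hz2 : ∀ u, b ≤ u → ∫ r in a..u, f r = x.1 + ∫ r in c..u - (b - c), w r := fun u hu => by
    rw [← intervalIntegral.integral_add_adjacent_intervals (b := b) hfi.intervalIntegrable
      hfi.intervalIntegrable, hz1 b (right_mem_Icc.2 hab), hx1]
    congr 1
    have h := intervalIntegral.integral_comp_sub_right (a := b) (b := u) w (b - c)
    rw [sub_sub_cancel] at h
    rw [← h]
    refine intervalIntegral.integral_congr_ae (.of_forall fun r hr => ?_)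
    rw [uIoc_of_le hu] at hr
    exact hf2 r hr.1
  have hed : e - (b - c) = d := by rw [he]; ring
  have hsplit : ∀ {F G H : ℝ → ℝ}, Integrable F → (∀ u ∈ Icc a b, F u = G u) →
      (∀ u, b < u → F u = H (u - (b - c))) →
      ∫ u in a..e, F u = (∫ u in a..b, G u) + ∫ u in c..d, H u := fun {F G H} hF hG hH => by
    rw [← intervalIntegral.integral_add_adjacent_intervals (b := b) hF.intervalIntegrable
      hF.intervalIntegrable]
    have h := intervalIntegral.integral_comp_sub_right (a := b) (b := e) H (b - c)
    rw [sub_sub_cancel, hed] at h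
    rw [← h]
    congr 1
    · refine intervalIntegral.integral_congr fun u hu => hG u ?_
      rwa [uIcc_of_le hab] at hu
    · refine intervalIntegral.integral_congr_ae (.of_forall fun u hu => hH u ?_)
      rw [uIoc_of_le hbe] at hu
      exact hu.1
  have hfs := integrable_symp_primitive hfi 0 a
  simp only [zero_add] at hfs
  refine ⟨a, e, f, hab.trans hbe, hfi, ?_, ?_, ?_⟩
  · rw [hz2 e hbe, hed, hy1, hmul]
  · rw [area, hsplit hfs (G := fun u => 2 * symp (∫ r in a..u, v r) (v u))
      (H := fun u => 2 * symp (x.1 + ∫ r in c..u, w r) (w u))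
      (fun u hu => by rw [hz1 u hu, hf1 u hu.2]) (fun u hu => by rw [hz2 u hu.le, hf2 u hu]),
      integral_symp_add hw, hy1, hy2, ← area, hx2, hmul]
    ring
  · exact hsplit (hN.integrable_comp hfi) (fun u hu => by rw [hf1 u hu.2])
      (H := fun u => N (w u)) (fun u hu => by rw [hf2 u hu])

theorem horiz (p : V n) : Reach N (p, 0) (N p) := by
  have h : ∀ s ∈ Icc (0 : ℝ) 1,
      EqOn ((Icc (0 : ℝ) 1).indicator fun _ => p) (fun _ => p) (uIcc 0 s) :=
    fun s hs u hu => indicator_of_mem (by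
      rw [uIcc_of_le hs.1] at hu
      exact ⟨hu.1, hu.2.trans hs.2⟩) _
  have hz : ∀ s ∈ Icc (0 : ℝ) 1,
      ∫ u in (0 : ℝ)..s, (Icc (0 : ℝ) 1).indicator (fun _ => p) u = s • p := fun s hs => by
    rw [intervalIntegral.integral_congr (h s hs)]; simp
  have h1 : (1 : ℝ) ∈ Icc (0 : ℝ) 1 := by simp
  refine ⟨0, 1, (Icc (0 : ℝ) 1).indicator fun _ => p, zero_le_one,
    (integrable_indicator_iff measurableSet_Icc).2 (integrableOn_const (by simp)), ?_, ?_, ?_⟩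
  · simpa using hz 1 h1
  · rw [area, intervalIntegral.integral_congr (g := fun _ => 0)]
    · simp
    · intro u hu
      have hu' : u ∈ Icc (0 : ℝ) 1 := by rwa [uIcc_of_le zero_le_one] at hu
      simp only [hz u hu', h 1 h1 hu, symp_smul_left, symp_self, mul_zero]
  · rw [intervalIntegral.integral_congr (g := fun _ => N p)]
    · simp
    · intro u hu
      simp only [h 1 h1 hu]

theorem length_nonneg (hN : IsNorm N) (hx : Reach N x L) : 0 ≤ L := by
  obtain ⟨a, b, v, hab, hv, -, -, rfl⟩ := hx
  exact intervalIntegral.integral_nonneg hab fun u _ => hN.nonneg _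

theorem le_length (hN : IsNorm N) (hx : Reach N x L) : N x.1 ≤ L := by
  obtain ⟨a, b, v, hab, hv, h1, -, rfl⟩ := hx
  rw [← h1]
  exact hN.map_integral_le hv hab

end Reach

theorem IsNorm.exists_abs_snd_le {n : ℕ} {N : V n → ℝ} (hN : IsNorm N) :
    ∃ C, 0 < C ∧ ∀ (x : Heis n) (L : ℝ), Reach N x L → |x.2| ≤ C * L ^ 2 := by
  obtain ⟨c, hc, hcN⟩ := hN.exists_norm_le
  refine ⟨2 * c ^ 2, by positivity, ?_⟩
  rintro x _ ⟨a, b, v, hab, hv, -, h2, rfl⟩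
  set L := ∫ u in a..b, N (v u) with hL
  have hNi := hN.integrable_comp hv
  have hz : ∀ u ∈ Icc a b, N (∫ r in a..u, v r) ≤ L := fun u hu =>
    (hN.map_integral_le hv hu.1).trans (intervalIntegral.integral_mono_interval le_rfl hu.1 hu.2
      (.of_forall fun _ => hN.nonneg _) hNi.intervalIntegrable)
  rw [← h2, area, ← Real.norm_eq_abs]
  calc ‖∫ u in a..b, 2 * symp (∫ r in a..u, v r) (v u)‖
      ≤ ∫ u in a..b, 2 * c ^ 2 * L * N (v u) := by
        refine intervalIntegral.norm_integral_le_of_norm_le hab (.of_forall fun u hu => ?_)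
          (hNi.const_mul _).intervalIntegrable
        rw [norm_mul, Real.norm_ofNat, Real.norm_eq_abs]
        calc 2 * |symp (∫ r in a..u, v r) (v u)| ≤ 2 * (‖∫ r in a..u, v r‖ * ‖v u‖) := by
              gcongr
              exact abs_symp_le _ _
          _ ≤ 2 * ((c * L) * (c * N (v u))) := by
              have h1 : ‖∫ r in a..u, v r‖ ≤ c * L := (hcN _).trans
                (mul_le_mul_of_nonneg_left (hz u (Ioc_subset_Icc_self hu)) hc.le)
              have h0 := (norm_nonneg _).trans h1
              gcongr
              exact hcN _
          _ = _ := by ring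
    _ = 2 * c ^ 2 * L ^ 2 := by
        rw [intervalIntegral.integral_const_mul, ← hL]; ring

namespace Reach

variable {n : ℕ} {N : V n → ℝ} {x : Heis n} {L : ℝ}

/-- Conjugation by a horizontal element only changes the vertical coordinate. -/
theorem conj (hN : IsNorm N) (hx : Reach N x L) (p : V n) :
    Reach N (x.1, x.2 + 4 * symp p x.1) (L + 2 * N p) := by
  have h := ((horiz p).mul hN hx).mul hN (horiz (-p))
  rw [hN.map_neg] at h
  convert h using 1
  · refine Prod.ext (by simp [hmul]) ?_
    simp only [hmul, symp_add_left, symp_neg_right, symp_self]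
    rw [symp_swap p x.1]
    ring
  · ring

end Reach

/-- Vertical displacements by `t` cost at most a multiple of `√|t|`. -/
theorem IsNorm.exists_reach_vertical {n : ℕ} {N : V n → ℝ} (hN : IsNorm N) {q : V n}
    (hq : q ≠ 0) : ∃ C, 0 < C ∧ ∀ t : ℝ, Reach N (0, t) (C * √|t|) := by
  have hq' : 0 < ‖q‖ := norm_pos_iff.2 hq
  obtain ⟨e, he1⟩ : ∃ e : V n, 4 * symp (Jmat n e) e = 1 := by
    refine ⟨(2 * ‖q‖)⁻¹ • q, ?_⟩
    rw [symp_Jmat_self, norm_smul, Real.norm_of_nonneg (by positivity)]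
    field_simp
    norm_num
  have he0 : e ≠ 0 := by
    intro h
    rw [h, symp_zero_right] at he1
    norm_num at he1
  have hNe : 0 < N e := (hN.nonneg e).lt_of_ne fun h => he0 ((hN.eq_zero_iff e).1 h.symm)
  refine ⟨2 * N e + 2 * N (Jmat n e), by have := hN.nonneg (Jmat n e); positivity, fun t => ?_⟩
  have hσ : √|t| * √|t| = |t| := Real.mul_self_sqrt (abs_nonneg t)
  obtain ⟨σ, hσ1, hσt⟩ : ∃ σ : ℝ, |σ| = √|t| ∧ σ * √|t| = t := by
    rcases abs_cases t with ⟨h, -⟩ | ⟨h, -⟩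
    · exact ⟨√|t|, abs_of_nonneg (Real.sqrt_nonneg _), by rw [hσ, h]⟩
    · exact ⟨-√|t|, by rw [abs_neg, abs_of_nonneg (Real.sqrt_nonneg _)], by
        rw [neg_mul, hσ, h, neg_neg]⟩
  have h := ((Reach.horiz (N := N) (√|t| • e)).conj hN (σ • Jmat n e)).mul hN
    (Reach.horiz (-(√|t| • e)))
  convert h using 1
  · refine Prod.ext (by simp [hmul]) ?_
    simp only [hmul, symp_neg_right, symp_self, symp_smul_left, symp_smul_right]
    linear_combination (-σ * √|t|) * he1 - hσt
  · rw [hN.map_neg, hN.smul, hN.smul, hσ1, abs_of_nonneg (Real.sqrt_nonneg _)]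
    ring

/-- The element `γ(s)⁻¹ * γ(t)`. -/
def incr {n : ℕ} (γ : ℝ → Heis n) (s t : ℝ) : Heis n := hmul (hinv (γ s)) (γ t)

theorem incr_fst {n : ℕ} (γ : ℝ → Heis n) (s t : ℝ) : (incr γ s t).1 = (γ t).1 - (γ s).1 := by
  simp only [incr, hmul, hinv]; abel

theorem incr_snd {n : ℕ} (γ : ℝ → Heis n) (s t : ℝ) :
    (incr γ s t).2 = (γ t).2 - (γ s).2 - 2 * symp (γ s).1 (γ t).1 := by
  simp only [incr, hmul, hinv, symp_neg_left]; ring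

theorem incr_snd_add {n : ℕ} (γ : ℝ → Heis n) (r s t : ℝ) :
    (incr γ r t).2 = (incr γ r s).2 + (incr γ s t).2
      + 2 * symp ((γ s).1 - (γ r).1) ((γ t).1 - (γ s).1) := by
  simp only [incr_snd, sub_eq_add_neg, symp_add_left, symp_add_right, symp_neg_left,
    symp_neg_right, symp_self]
  ring

theorem hmul_incr_incr {n : ℕ} (γ : ℝ → Heis n) (r s t : ℝ) :
    hmul (incr γ r s) (incr γ s t) = incr γ r t := by
  refine Prod.ext ?_ ?_
  · simp only [hmul, incr_fst]; abel
  · rw [incr_snd_add γ r s t]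
    simp only [hmul, incr_fst]

theorem hmul_incr {n : ℕ} (γ : ℝ → Heis n) (s t : ℝ) : hmul (γ s) (incr γ s t) = γ t := by
  refine Prod.ext ?_ ?_
  · simp only [hmul, incr_fst]; abel
  · simp only [hmul, incr_fst, incr_snd, sub_eq_add_neg, symp_add_right, symp_neg_right, symp_self]
    ring

section Geodesic

variable {n : ℕ} {N : V n → ℝ} {γ : ℝ → Heis n}

theorem sub_le_of_reach_incr (hN : IsNorm N) (hgeo : ∀ s s' : ℝ, dSF n N (γ s) (γ s') = |s - s'|)
    {s t L : ℝ} (h : Reach N (incr γ s t) L) : t - s ≤ L := by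
  refine (le_abs_self _).trans ?_
  rw [abs_sub_comm, ← hgeo, dSF_eq]
  exact csInf_le ⟨0, fun M hM => Reach.length_nonneg hN hM⟩ h

theorem exists_reach_incr_lt (hgeo : ∀ s s' : ℝ, dSF n N (γ s) (γ s') = |s - s'|)
    {s t ε : ℝ} (hst : s < t) (hε : 0 < ε) :
    ∃ L, Reach N (incr γ s t) L ∧ L < t - s + ε := by
  have hd : sInf {L | Reach N (incr γ s t) L} = t - s := by
    rw [incr, ← dSF_eq, hgeo, abs_sub_comm, abs_of_pos (sub_pos.2 hst)]
  have hne : {L | Reach N (incr γ s t) L}.Nonempty := by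
    by_contra h
    rw [not_nonempty_iff_eq_empty.1 h, Real.sInf_empty] at hd
    linarith
  exact exists_lt_of_csInf_lt hne (hd.trans_lt (by linarith))

theorem norm_fst_sub_le (hN : IsNorm N) (hgeo : ∀ s s' : ℝ, dSF n N (γ s) (γ s') = |s - s'|)
    {s t : ℝ} (hst : s ≤ t) : N ((γ t).1 - (γ s).1) ≤ t - s := by
  rcases hst.eq_or_lt with rfl | hst
  · simp [hN.map_zero]
  refine le_of_forall_pos_lt_add fun ε hε => ?_
  obtain ⟨L, hL, hlt⟩ := exists_reach_incr_lt hgeo hst hε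
  rw [← incr_fst]
  exact (hL.le_length hN).trans_lt hlt

theorem exists_abs_incr_snd_le (hN : IsNorm N)
    (hgeo : ∀ s s' : ℝ, dSF n N (γ s) (γ s') = |s - s'|) :
    ∃ C, 0 < C ∧ ∀ s t : ℝ, s < t → |(incr γ s t).2| ≤ C * (t - s) ^ 2 := by
  obtain ⟨C, hC, h⟩ := hN.exists_abs_snd_le
  refine ⟨C * 4, by positivity, fun s t hst => ?_⟩
  obtain ⟨L, hL, hlt⟩ := exists_reach_incr_lt hgeo hst (sub_pos.2 hst)
  have hL0 := hL.length_nonneg hN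
  calc |(incr γ s t).2| ≤ C * L ^ 2 := h _ _ hL
    _ ≤ C * (t - s + (t - s)) ^ 2 := by gcongr
    _ = C * 4 * (t - s) ^ 2 := by ring

theorem exists_ne_zero_of_geodesic (hN : IsNorm N)
    (hgeo : ∀ s s' : ℝ, dSF n N (γ s) (γ s') = |s - s'|) : ∃ q : V n, q ≠ 0 := by
  by_contra! h
  obtain ⟨L, hL, -⟩ := exists_reach_incr_lt hgeo (zero_lt_one' ℝ) one_pos
  have h1 := sub_le_of_reach_incr hN hgeo hL
  obtain ⟨a, b, v, -, -, -, -, h3⟩ := hL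
  simp only [h (v _), hN.map_zero, intervalIntegral.integral_zero] at h3
  linarith

/-- The horizontal projection of an infinite geodesic is unbounded: otherwise the vertical
coordinate would grow at most linearly, and hence the distance like a square root. -/
theorem exists_lt_norm_fst_sub (hN : IsNorm N)
    (hgeo : ∀ s s' : ℝ, dSF n N (γ s) (γ s') = |s - s'|) (b R : ℝ) :
    ∃ m : ℕ, R < N ((γ (b + m)).1 - (γ b).1) := by
  by_contra! hR
  obtain ⟨q, hq⟩ := exists_ne_zero_of_geodesic hN hgeo
  obtain ⟨E, hE, hvert⟩ := hN.exists_reach_vertical hq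
  obtain ⟨C, hC, hstep⟩ := exists_abs_incr_snd_le hN hgeo
  obtain ⟨c, hc, hcN⟩ := hN.exists_norm_le
  have hR0 : 0 ≤ R := (hN.nonneg _).trans (hR 0)
  set D := C + 2 * ((c * R) * c) with hD
  have hD0 : 0 < D := by positivity
  have hlin : ∀ m : ℕ, |(incr γ b (b + m)).2| ≤ D * m := by
    intro m
    induction m with
    | zero => simp [incr_snd, symp_self]
    | succ m ih =>
      have hlt : b + m < b + (m + 1 : ℕ) := by push_cast; linarith
      have h1 := hstep _ _ hlt
      have h2 := norm_fst_sub_le hN hgeo hlt.le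
      have hone : b + ((m + 1 : ℕ) : ℝ) - (b + m) = 1 := by push_cast; ring
      rw [hone] at h1 h2
      have h3 : |symp ((γ (b + m)).1 - (γ b).1) ((γ (b + (m + 1 : ℕ))).1 - (γ (b + m)).1)|
          ≤ (c * R) * (c * 1) := by
        refine (abs_symp_le _ _).trans (mul_le_mul ?_ ?_ (norm_nonneg _) (by positivity))
        · exact (hcN _).trans (mul_le_mul_of_nonneg_left (hR m) hc.le)
        · exact (hcN _).trans (mul_le_mul_of_nonneg_left h2 hc.le)
      rw [incr_snd_add γ b (b + m)]
      rw [abs_le] at *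
      push_cast at *
      constructor <;> nlinarith
  obtain ⟨m, hm⟩ := exists_nat_gt (2 * R + E ^ 2 * D)
  have hm0 : (0 : ℝ) < m := lt_of_le_of_lt (by positivity) hm
  have hreach : Reach N (incr γ b (b + m))
      (N (incr γ b (b + m)).1 + E * √|(incr γ b (b + m)).2|) := by
    convert (Reach.horiz (incr γ b (b + m)).1).mul hN (hvert (incr γ b (b + m)).2) using 1
    exact Prod.ext (by simp [hmul]) (by simp [hmul, symp_zero_right])
  have h1 := sub_le_of_reach_incr hN hgeo hreach
  rw [incr_fst] at h1
  have h2 : √|(incr γ b (b + m)).2| ≤ √(D * m) := Real.sqrt_le_sqrt (hlin m)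
  have h3 : (m : ℝ) - R ≤ E * √(D * m) := by
    have := mul_le_mul_of_nonneg_left h2 hE.le
    linarith [hR m]
  have hmR : 0 ≤ (m : ℝ) - R := by nlinarith [sq_nonneg E]
  have h4 : ((m : ℝ) - R) ^ 2 ≤ E ^ 2 * (D * m) := by
    calc ((m : ℝ) - R) ^ 2 ≤ (E * √(D * m)) ^ 2 := by gcongr
      _ = E ^ 2 * (D * m) := by rw [mul_pow, Real.sq_sqrt (by positivity)]
  nlinarith [sq_nonneg R]

/-- Over every interval, the horizontal projection of an infinite geodesic moves at full speed:
otherwise one replaces the projected arc by its chord and restores the vertical coordinate, at an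
arbitrarily small cost, by conjugating a long piece of the geodesic by a small horizontal
element. -/
theorem norm_fst_sub_eq (hN : IsNorm N)
    (hgeo : ∀ s s' : ℝ, dSF n N (γ s) (γ s') = |s - s'|) {a b : ℝ} (hab : a < b) :
    N ((γ b).1 - (γ a).1) = b - a := by
  refine (norm_fst_sub_le hN hgeo hab.le).antisymm (le_of_not_gt fun hlt => ?_)
  obtain ⟨C, hC, hCN⟩ := hN.exists_le_norm
  set ε := b - a - N ((γ b).1 - (γ a).1) with hε
  have hε0 : 0 < ε := sub_pos.2 hlt
  set τ := (incr γ a b).2 with hτ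
  obtain ⟨m, hm⟩ := exists_lt_norm_fst_sub hN hgeo b (b - a + C ^ 2 * |τ| / ε)
  have hm0 : (0 : ℝ) < m := by
    rcases Nat.eq_zero_or_pos m with rfl | h
    · have : 0 ≤ C ^ 2 * |τ| / ε := by positivity
      simp [hN.map_zero] at hm
      linarith
    · exact_mod_cast h
  set T := b + (m : ℝ) with hT
  have hbT : b < T := by linarith
  set Z := (γ T).1 - (γ a).1 with hZ
  have hNZ : C ^ 2 * |τ| / ε < N Z := by
    have h1 := hN.triangle Z (-((γ b).1 - (γ a).1))
    rw [hN.map_neg, show Z + -((γ b).1 - (γ a).1) = (γ T).1 - (γ b).1 by rw [hZ]; abel] at h1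
    linarith
  have hZ0 : 0 < ‖Z‖ := by
    have h1 : 0 ≤ C ^ 2 * |τ| / ε := by positivity
    exact pos_of_mul_pos_right ((h1.trans_lt hNZ).trans_le (hCN Z)) hC.le
  set p := (τ / (4 * ‖Z‖ ^ 2)) • Jmat n Z with hp
  have hpZ : 4 * symp p Z = τ := by
    rw [hp, symp_smul_left, symp_Jmat_self]; field_simp
  have hNp : 2 * N p < ε / 2 := by
    have h1 : N p ≤ |τ| / (4 * ‖Z‖ ^ 2) * (C * ‖Z‖) := by
      rw [hp, hN.smul, abs_div, abs_of_pos (by positivity : 0 < 4 * ‖Z‖ ^ 2)]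
      gcongr
      simpa only [norm_Jmat] using hCN (Jmat n Z)
    have h2 : |τ| / (4 * ‖Z‖ ^ 2) * (C * ‖Z‖) = C * |τ| / (4 * ‖Z‖) := by field_simp
    have h3 : C ^ 2 * |τ| < C * ‖Z‖ * ε := (div_lt_iff₀ hε0).1 (hNZ.trans_le (hCN Z))
    have h4 : C * |τ| < ‖Z‖ * ε := by nlinarith
    have h5 : C * |τ| / (4 * ‖Z‖) < ε / 4 := by
      rw [div_lt_iff₀ (by positivity)]; linarith
    linarith
  obtain ⟨L, hL, hLlt⟩ := exists_reach_incr_lt hgeo hbT (half_pos hε0)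
  have hreach := ((Reach.horiz (incr γ a b).1).mul hN hL).conj hN p
  have heq : hmul ((incr γ a b).1, 0) (incr γ b T) =
      ((incr γ a T).1, (incr γ a T).2 - τ) := by
    rw [← hmul_incr_incr γ a b T]
    refine Prod.ext (by simp [hmul]) ?_
    simp only [hmul, hτ]
    ring
  rw [heq] at hreach
  simp only [incr_fst, ← hZ, hpZ, sub_add_cancel] at hreach
  rw [show (Z, (incr γ a T).2) = incr γ a T from Prod.ext (incr_fst γ a T).symm rfl] at hreach
  have := sub_le_of_reach_incr hN hgeo hreach
  linarith

theorem smul_fst_sub_eq (hN : IsNorm N) (hsc : StrictlyConvexNorm N)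
    (hgeo : ∀ s s' : ℝ, dSF n N (γ s) (γ s') = |s - s'|) {a b c : ℝ} (hab : a < b) (hbc : b < c) :
    (b - a) • ((γ c).1 - (γ b).1) = (c - b) • ((γ b).1 - (γ a).1) := by
  have h1 := norm_fst_sub_eq hN hgeo hab
  have h2 := norm_fst_sub_eq hN hgeo hbc
  have h3 := norm_fst_sub_eq hN hgeo (hab.trans hbc)
  have hne : ∀ {z : V n} {r : ℝ}, N z = r → 0 < r → z ≠ 0 := by
    rintro z r rfl hr rfl
    exact hr.ne' hN.map_zero
  obtain ⟨α, hα, h⟩ := hsc ((γ b).1 - (γ a).1) ((γ c).1 - (γ b).1) (hne h1 (sub_pos.2 hab))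
    (hne h2 (sub_pos.2 hbc)) (by
      rw [show (γ b).1 - (γ a).1 + ((γ c).1 - (γ b).1) = (γ c).1 - (γ a).1 by abel, h1, h2, h3]
      ring)
  rw [h, hN.smul, abs_of_pos hα, h1] at h2
  rw [h, smul_smul, ← h2, mul_comm α]

theorem fst_eq_add_smul (hN : IsNorm N) (hsc : StrictlyConvexNorm N)
    (hgeo : ∀ s s' : ℝ, dSF n N (γ s) (γ s') = |s - s'|) (s : ℝ) :
    (γ s).1 = (γ 0).1 + s • ((γ 1).1 - (γ 0).1) := by
  have key : ∀ {a b c : ℝ}, a < b → b < c →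
      (b - a) • ((γ c).1 - (γ b).1) - (c - b) • ((γ b).1 - (γ a).1) = 0 :=
    fun h h' => sub_eq_zero.2 (smul_fst_sub_eq hN hsc hgeo h h')
  rcases lt_trichotomy s 0 with hs | rfl | hs
  · have h := key hs one_pos
    rw [← sub_eq_zero, ← h]
    module
  · simp
  rcases lt_trichotomy s 1 with hs1 | rfl | hs1
  · have h := key hs hs1
    rw [← sub_eq_zero, ← neg_eq_zero, ← h]
    module
  · simp
  · have h := key one_pos hs1
    rw [← sub_eq_zero, ← h]
    module

/-- A function whose increments are quadratically small is constant. -/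
theorem eq_of_abs_sub_le_mul_sq {f : ℝ → ℝ} {C : ℝ}
    (h : ∀ s t, s < t → |f t - f s| ≤ C * (t - s) ^ 2) (s t : ℝ) : f s = f t := by
  have h' : ∀ s t, |f t - f s| ≤ C * (t - s) ^ 2 := fun s t => by
    rcases lt_trichotomy s t with hst | rfl | hst
    · exact h s t hst
    · simp
    · rw [abs_sub_comm, ← neg_sub s t, neg_sq]; exact h t s hst
  have hd : ∀ s, HasDerivAt f 0 s := fun s => by
    rw [hasDerivAt_iff_isLittleO]
    simp only [smul_zero, sub_zero]
    have h1 : (fun t => f t - f s) =O[nhds s] fun t => ‖t - s‖ ^ 2 :=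
      Asymptotics.IsBigO.of_bound C (.of_forall fun t => by
        simpa using h' s t)
    exact h1.trans_isLittleO (Asymptotics.isLittleO_pow_sub_sub s one_lt_two)
  exact is_const_of_deriv_eq_zero (fun s => (hd s).differentiableAt) (fun s => (hd s).deriv) s t

end Geodesic

/-- If `N` is a strictly convex norm on `ℝ^{2n}`, then every infinite
geodesic of `(ℍⁿ, d_SF)` is a horizontal line `s ↦ g₀ * (s w, 0)` with `N w = 1`. -/
theorem stmt1 (n : ℕ) (N : V n → ℝ) (hN : IsNorm N) (hsc : StrictlyConvexNorm N)
    (γ : ℝ → Heis n) (hgeo : ∀ s s' : ℝ, dSF n N (γ s) (γ s') = |s - s'|) :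
    ∃ (g₀ : Heis n) (w : V n), N w = 1 ∧ ∀ s : ℝ, γ s = hmul g₀ (s • w, (0 : ℝ)) := by
  set w := (γ 1).1 - (γ 0).1 with hw
  have hfst := fst_eq_add_smul hN hsc hgeo
  obtain ⟨C, -, hC⟩ := exists_abs_incr_snd_le hN hgeo
  have hadd : ∀ s t, (incr γ 0 t).2 - (incr γ 0 s).2 = (incr γ s t).2 := fun s t => by
    rw [incr_snd_add γ 0 s t, hfst t, hfst s,
      show (γ 0).1 + s • w - (γ 0).1 = s • w by abel,
      show (γ 0).1 + t • w - ((γ 0).1 + s • w) = (t - s) • w by module,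
      symp_smul_left, symp_smul_right, symp_self]
    ring
  have hzero : ∀ s, (incr γ 0 s).2 = 0 := fun s => by
    rw [eq_of_abs_sub_le_mul_sq (f := fun s => (incr γ 0 s).2) (C := C)
      (fun s t hst => by rw [hadd]; exact hC s t hst) s 0, incr_snd, symp_self]
    ring
  refine ⟨γ 0, w, by rw [norm_fst_sub_eq hN hgeo one_pos, sub_zero], fun s => ?_⟩
  rw [← hmul_incr γ 0 s]
  congr 1
  exact Prod.ext (by rw [incr_fst, hfst s, add_sub_cancel_left]) (hzero s)

end
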